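/- χ = 0 is the unique real solution of the heterarchical altruism equation φ(χ)/(2(1 − Φ(χ))) − φ(χ)/(2Φ(χ)) − χ = 0. -/

import Mathlib

open MeasureTheory

/-- The standard normal probability density function. -/
noncomputable def stdGaussianPDF (x : ℝ) : ℝ :=
  Real.exp (-x ^ 2 / 2) / Real.sqrt (2 * Real.pi)

/-- The standard normal cumulative distribution function. -/
noncomputable def stdGaussianCDF (x : ℝ) : ℝ :=
  ∫ t in Set.Iic x, stdGaussianPDF t

open Filter Topology


lemma phi_eq : stdGaussianPDF = ProbabilityTheory.gaussianPDFReal 0 1 := by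
  funext x
  simp [stdGaussianPDF, ProbabilityTheory.gaussianPDFReal, div_eq_mul_inv, mul_comm]

lemma phi_pos (x : ℝ) : 0 < stdGaussianPDF x := by
  unfold stdGaussianPDF; positivity

lemma phi_int : Integrable stdGaussianPDF := by
  rw [phi_eq]; exact ProbabilityTheory.integrable_gaussianPDFReal 0 1

lemma phi_total : ∫ x, stdGaussianPDF x = 1 := by
  rw [phi_eq]; exact ProbabilityTheory.integral_gaussianPDFReal_eq_one 0 one_ne_zero

lemma phi_neg (x : ℝ) : stdGaussianPDF (-x) = stdGaussianPDF x := by simp [stdGaussianPDF]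

lemma phi_deriv (x : ℝ) : HasDerivAt stdGaussianPDF (-x * stdGaussianPDF x) x := by
  have h : HasDerivAt (fun x : ℝ => -x ^ 2 / 2) (-x) x := by
    have := ((hasDerivAt_pow 2 x).neg).div_const 2
    refine HasDerivAt.congr_deriv this ?_
    simp; ring
  have := (h.exp).div_const (Real.sqrt (2 * Real.pi))
  refine HasDerivAt.congr_deriv this ?_
  unfold stdGaussianPDF; ring

lemma phi_cont : Continuous stdGaussianPDF :=
  continuous_iff_continuousAt.2 fun x => (phi_deriv x).continuousAt

lemma one_sub_Phi (x : ℝ) : 1 - stdGaussianCDF x = ∫ t in Set.Ioi x, stdGaussianPDF t := by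
  have := intervalIntegral.integral_Iic_add_Ioi (b := x) phi_int.integrableOn phi_int.integrableOn
  rw [phi_total] at this
  unfold stdGaussianCDF; linarith

lemma Phi_neg (x : ℝ) : stdGaussianCDF (-x) = 1 - stdGaussianCDF x := by
  rw [one_sub_Phi]
  have := integral_comp_neg_Iic (-x) stdGaussianPDF
  simp only [phi_neg, neg_neg] at this
  exact this

lemma Phi_zero : stdGaussianCDF 0 = 1 / 2 := by
  have := Phi_neg 0
  simp only [neg_zero] at this; linarith

lemma Phi_deriv (x : ℝ) : HasDerivAt stdGaussianCDF (stdGaussianPDF x) x := by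
  have h : stdGaussianCDF = fun x => stdGaussianCDF 0 + ∫ t in (0:ℝ)..x, stdGaussianPDF t := by
    funext y
    have := intervalIntegral.integral_Iic_sub_Iic (a := 0) (b := y)
      phi_int.integrableOn phi_int.integrableOn
    unfold stdGaussianCDF; linarith
  rw [h]
  exact (phi_cont.integral_hasStrictDerivAt 0 x).hasDerivAt.const_add _

lemma Phi_strictMono : StrictMono stdGaussianCDF :=
  strictMono_of_hasDerivAt_pos Phi_deriv phi_pos

lemma Phi_pos (x : ℝ) : 0 < stdGaussianCDF x := by
  have h : 0 ≤ stdGaussianCDF (x - 1) := integral_nonneg fun t => (phi_pos t).le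
  exact h.trans_lt (Phi_strictMono (by linarith))

lemma Phi_lt_one (x : ℝ) : stdGaussianCDF x < 1 := by
  have := Phi_pos (-x); rw [Phi_neg] at this; linarith

lemma xphi_int : Integrable (fun x => x * stdGaussianPDF x) := by
  have := (integrable_mul_exp_neg_mul_sq (b := 1/2) (by norm_num)).div_const (Real.sqrt (2 * Real.pi))
  refine this.congr (Eventually.of_forall fun x => ?_)
  simp only [stdGaussianPDF]
  rw [show -(1/2 : ℝ) * x ^ 2 = -x ^ 2 / 2 by ring]; ring

lemma xphi_tendsto : Tendsto (fun x => x * stdGaussianPDF x) atTop (𝓝 0) := by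
  have h := (tendsto_rpow_abs_mul_exp_neg_mul_sq_cocompact (a := 1/2) (by norm_num) 1)
  have h2 := (h.mono_left atTop_le_cocompact).div_const (Real.sqrt (2 * Real.pi))
  rw [zero_div] at h2
  refine h2.congr' ?_
  filter_upwards [eventually_ge_atTop 0] with x hx
  simp only [stdGaussianPDF, Real.rpow_one, abs_of_nonneg hx]
  rw [show -(1/2 : ℝ) * x ^ 2 = -x ^ 2 / 2 by ring]; ring

lemma phi_tendsto : Tendsto stdGaussianPDF atTop (𝓝 0) := by
  refine squeeze_zero' (Eventually.of_forall fun x => (phi_pos x).le) ?_ xphi_tendsto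
  filter_upwards [eventually_ge_atTop 1] with x hx
  nlinarith [phi_pos x]

lemma mills (x : ℝ) : x * (1 - stdGaussianCDF x) ≤ stdGaussianPDF x := by
  have h := integral_Ioi_of_hasDerivAt_of_tendsto' (a := x) (f := fun t => - stdGaussianPDF t)
    (f' := fun t => t * stdGaussianPDF t) (m := 0)
    (fun t _ => (phi_deriv t).neg.congr_deriv (by ring)) xphi_int.integrableOn
    (by simpa using phi_tendsto.neg)
  rw [one_sub_Phi, ← integral_const_mul]
  have h2 : ∫ t in Set.Ioi x, x * stdGaussianPDF t ≤ ∫ t in Set.Ioi x, t * stdGaussianPDF t := by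
    refine setIntegral_mono_on (phi_int.const_mul x).integrableOn xphi_int.integrableOn
      measurableSet_Ioi fun t ht => ?_
    exact mul_le_mul_of_nonneg_right (le_of_lt ht) (phi_pos t).le
  rw [h] at h2
  linarith

lemma tail_tendsto : Tendsto (fun x => x * (1 - stdGaussianCDF x)) atTop (𝓝 0) := by
  refine squeeze_zero' ?_ (Eventually.of_forall mills) phi_tendsto
  filter_upwards [eventually_ge_atTop 0] with x hx
  exact mul_nonneg hx (by linarith [Phi_lt_one x])

lemma Phi_tendsto : Tendsto (fun x => 1 - stdGaussianCDF x) atTop (𝓝 0) := by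
  refine squeeze_zero' (Eventually.of_forall fun x => by linarith [Phi_lt_one x]) ?_ tail_tendsto
  filter_upwards [eventually_ge_atTop 1] with x hx
  nlinarith [Phi_lt_one x]

/-- Sign pattern: positive and then negative. -/
def DownSign (d : ℝ → ℝ) : Prop := ∀ x y, 0 < x → x < y → d x ≤ 0 → d y < 0

lemma exists_mvt {f d : ℝ → ℝ} (h : ∀ x, HasDerivAt f (d x) x) {a b : ℝ} (hab : a < b) :
    ∃ c ∈ Set.Ioo a b, f b - f a = d c * (b - a) := by
  obtain ⟨c, hc, e⟩ := exists_hasDerivAt_eq_slope f d hab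
    (fun x _ => (h x).continuousAt.continuousWithinAt) (fun x _ => h x)
  refine ⟨c, hc, ?_⟩
  rw [e]; field_simp [sub_ne_zero.2 hab.ne']

lemma DownSign.integrate {f d : ℝ → ℝ} (h : ∀ x, HasDerivAt f (d x) x) (hd : DownSign d)
    (h0 : 0 ≤ f 0) : DownSign f := by
  intro x y hx hxy hfx
  obtain ⟨c, hc, e⟩ := exists_mvt h hx
  obtain ⟨c', hc', e'⟩ := exists_mvt h hxy
  have h1 : d c ≤ 0 := by
    by_contra hh; push Not at hh
    nlinarith [mul_pos hh (sub_pos.2 hx)]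
  have h2 := hd c c' hc.1 (hc.2.trans hc'.1) h1
  nlinarith [mul_pos_of_neg_of_neg h2 (sub_neg.2 hxy)]

lemma F_neg {x : ℝ} (hx : 0 < x) :
    x * (stdGaussianCDF x - 1/2)^2 + stdGaussianPDF x * (stdGaussianCDF x - 1/2) - x / 4 < 0 := by
  let u : ℝ → ℝ := fun x => stdGaussianCDF x - 1/2
  have hu : ∀ x, HasDerivAt u (stdGaussianPDF x) x := fun x => (Phi_deriv x).sub_const _
  have hp := phi_deriv
  let g : ℝ → ℝ := fun x => 2 * (stdGaussianPDF x - x * u x)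
  let G : ℝ → ℝ := fun x => 3 * u x - x^2 * u x - x * stdGaussianPDF x
  let F : ℝ → ℝ := fun x => x * u x ^ 2 + stdGaussianPDF x * u x - x / 4
  let F1 : ℝ → ℝ := fun x => u x ^ 2 + x * u x * stdGaussianPDF x + stdGaussianPDF x ^ 2 - 1 / 4
  let F2 : ℝ → ℝ := fun x => stdGaussianPDF x * G x
  have hu0 : u 0 = 0 := by simp [u, Phi_zero]
  have dg : ∀ x, HasDerivAt g (2 * (-x * stdGaussianPDF x - (u x + x * stdGaussianPDF x))) x := fun x => by
    have := ((hp x).sub ((hasDerivAt_id x).mul (hu x))).const_mul 2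
    refine HasDerivAt.congr_deriv this ?_
    simp
  have dG : ∀ x, HasDerivAt G (g x) x := fun x => by
    have := (((hu x).const_mul 3).sub ((hasDerivAt_pow 2 x).mul (hu x))).sub
      ((hasDerivAt_id x).mul (hp x))
    refine HasDerivAt.congr_deriv this ?_
    simp [g]; ring
  have dF : ∀ x, HasDerivAt F (F1 x) x := fun x => by
    have := (((hasDerivAt_id x).mul ((hu x).pow 2)).add ((hp x).mul (hu x))).sub
      ((hasDerivAt_id x).div_const 4)
    refine HasDerivAt.congr_deriv this ?_
    simp [F1]; ring
  have dF1 : ∀ x, HasDerivAt F1 (F2 x) x := fun x => by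
    have := ((((hu x).pow 2).add (((hasDerivAt_id x).mul (hu x)).mul (hp x))).add
      ((hp x).pow 2)).sub_const (1/4)
    refine HasDerivAt.congr_deriv this ?_
    simp [F2, G]; ring
  have sg : DownSign g := by
    intro x y hx hxy hgx
    obtain ⟨c, hc, e⟩ := exists_mvt dg hxy
    have hc0 : 0 < c := hx.trans hc.1
    have huc : 0 < u c := by
      have := Phi_strictMono hc0
      rw [Phi_zero] at this; simp only [u]; linarith
    have : 0 < (u c + 2 * (c * stdGaussianPDF c)) * (y - x) :=
      mul_pos (by have := mul_pos hc0 (phi_pos c); linarith) (sub_pos.2 hxy)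
    nlinarith
  have sG : DownSign G := sg.integrate dG (by simp [G, hu0])
  have sF2 : DownSign F2 := by
    intro x y hx hxy h
    have : G x ≤ 0 := by
      by_contra hh; push Not at hh
      exact absurd h (not_le.2 (mul_pos (phi_pos x) hh))
    exact mul_neg_of_pos_of_neg (phi_pos y) (sG x y hx hxy this)
  have lu : Tendsto u atTop (𝓝 (1/2)) := by
    have := Phi_tendsto.const_sub (1/2)
    rw [sub_zero] at this
    refine this.congr fun x => ?_
    simp only [u]; ring
  have lF : Tendsto F atTop (𝓝 0) := by
    have := (phi_tendsto.mul lu).sub (tail_tendsto.mul (lu.add_const (1/2)))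
    simp only [zero_mul, sub_zero] at this
    refine this.congr fun x => ?_
    simp only [F, u]; ring
  have lF1 : Tendsto F1 atTop (𝓝 0) := by
    have := (((lu.pow 2).add (xphi_tendsto.mul lu)).add (phi_tendsto.pow 2)).sub_const (1/4)
    norm_num at this
    refine this.congr fun x => ?_
    simp only [F1]; ring
  have sF1 : ∀ x y, 0 < x → x < y → 0 ≤ F1 x → 0 < F1 y := by
    intro x y hx hxy h
    by_contra! hy
    obtain ⟨c, hc, e⟩ := exists_mvt dF1 hxy
    have hc2 : F2 c ≤ 0 := by
      by_contra! hh
      nlinarith [mul_pos hh (sub_pos.2 hxy)]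
    have key : ∀ a b, c < a → a < b → F1 b < F1 a := by
      intro a b ha hab
      obtain ⟨c', hc', e'⟩ := exists_mvt dF1 hab
      have := sF2 c c' (hx.trans hc.1) (ha.trans hc'.1) hc2
      nlinarith [mul_pos_of_neg_of_neg this (sub_neg.2 hab)]
    have h1 : F1 (y+1) < 0 := (key y (y+1) hc.2 (by linarith)).trans_le hy
    have h2 : (0:ℝ) ≤ F1 (y+1) := by
      refine le_of_tendsto lF1 ?_
      filter_upwards [eventually_gt_atTop (y+1)] with z hz
      exact (key _ _ (by linarith [hc.2]) hz).le
    linarith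
  change F x < 0
  by_contra! hFx
  obtain ⟨c, hc, e⟩ := exists_mvt dF hx
  have hF0 : F 0 = 0 := by simp [F, hu0]
  have hc1 : 0 ≤ F1 c := by
    by_contra! hh
    nlinarith [mul_pos_of_neg_of_neg hh (sub_neg.2 hx)]
  have key : ∀ a b, c < a → a < b → F a < F b := by
    intro a b ha hab
    obtain ⟨c', hc', e'⟩ := exists_mvt dF hab
    have := sF1 c c' hc.1 (ha.trans hc'.1) hc1
    nlinarith [mul_pos this (sub_pos.2 hab)]
  have h1 : 0 < F (x+1) := hFx.trans_lt (key x (x+1) hc.2 (by linarith))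
  have h2 : F (x+1) ≤ 0 := by
    refine ge_of_tendsto lF ?_
    filter_upwards [eventually_gt_atTop (x+1)] with z hz
    exact (key _ _ (by linarith [hc.2]) hz).le
  linarith

/-- `χ = 0` is the unique real solution of the heterarchical altruism equation
`φ(χ)/(2(1 − Φ(χ))) − φ(χ)/(2Φ(χ)) − χ = 0`. -/
theorem heterarchical_altruism_equation_unique_solution (χ : ℝ) :
    stdGaussianPDF χ / (2 * (1 - stdGaussianCDF χ)) -
        stdGaussianPDF χ / (2 * stdGaussianCDF χ) - χ = 0 ↔ χ = 0 := by
  have hP := Phi_pos χ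
  have hQ : 0 < 1 - stdGaussianCDF χ := by linarith [Phi_lt_one χ]
  have e : stdGaussianPDF χ / (2 * (1 - stdGaussianCDF χ)) - stdGaussianPDF χ / (2 * stdGaussianCDF χ) - χ =
      (χ * (stdGaussianCDF χ - 1/2)^2 + stdGaussianPDF χ * (stdGaussianCDF χ - 1/2) - χ / 4) / (stdGaussianCDF χ * (1 - stdGaussianCDF χ)) := by
    field_simp
    ring
  rw [e, div_eq_zero_iff, or_iff_left (mul_pos hP hQ).ne']
  constructor
  · intro h
    rcases lt_trichotomy χ 0 with hx | hx | hx
    · have := F_neg (neg_pos.2 hx)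
      rw [Phi_neg, phi_neg] at this
      nlinarith
    · exact hx
    · exact absurd h (F_neg hx).ne
  · rintro rfl
    simp [Phi_zero]
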